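/- Suppose h belongs to ℛ (i.e. Case 1 or Case 2 holds). With L(t) := (log t)³, x̂ := ψ(t) and σ̂ := σ(ψ(t)), both |h''(x̂)| σ̂⁴ → 0 and |h''(x̂)| σ̂³ L(t) → 0 as t → ∞. -/

import Mathlib

open Real Filter MeasureTheory Set ProbabilityTheory Asymptotics

noncomputable section

/-- `f` is regularly varying at infinity with index `α`: `f` is eventually positive and
`f (λ t) / f t → λ ^ α` as `t → ∞` for every `λ > 0`. -/
def RegVary (α : ℝ) (f : ℝ → ℝ) : Prop :=
  (∀ᶠ x in atTop, 0 < f x) ∧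
  ∀ lam : ℝ, 0 < lam →
    Tendsto (fun t => f (lam * t) / f t) atTop (nhds (lam ^ α))

/-- Case 1 (the regularly varying case) for the function `h = g'`:
`h x = c x^β exp (∫₁^x ε(u)/u du)` with `β > 0`, `c > 0`, `ε` twice differentiable with
`ε(x) → 0`, `x ε'(x) = O(1)`, `x² ε''(x) = O(1)`, and `|h''| ∈ RV(θ)` for some `θ ≤ β - 2`. -/
structure Case1 (h : ℝ → ℝ) (β c θ : ℝ) (ε : ℝ → ℝ) : Prop where
  beta_pos : 0 < β
  c_pos : 0 < c
  h_eq : ∀ x ≥ (1:ℝ), h x = c * x ^ β * Real.exp (∫ u in (1:ℝ)..x, ε u / u)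
  eps_diff : ∀ x ≥ (1:ℝ), DifferentiableAt ℝ ε x
  eps_diff2 : ∀ x ≥ (1:ℝ), DifferentiableAt ℝ (deriv ε) x
  eps_to_zero : Tendsto ε atTop (nhds 0)
  eps_deriv_bigO : (fun x => x * deriv ε x) =O[atTop] (fun _ => (1:ℝ))
  eps_deriv2_bigO : (fun x => x ^ 2 * deriv (deriv ε) x) =O[atTop] (fun _ => (1:ℝ))
  h2_RV : RegVary θ (fun x => |deriv (deriv h) x|)
  theta_le : θ ≤ β - 2

/-- Case 2 (the rapidly varying case), stated through `ψ = h⁻¹`: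
`ψ t = c exp (∫₁^t ε(u)/u du)` with `c > 0`, `ε` twice differentiable with `ε(t) → 0`,
`t ε'(t)/ε(t) → 0` and `t² ε''(t)/ε(t) → 0`. -/
structure Case2 (ψ : ℝ → ℝ) (c : ℝ) (ε : ℝ → ℝ) : Prop where
  c_pos : 0 < c
  psi_eq : ∀ t ≥ (1:ℝ), ψ t = c * Real.exp (∫ u in (1:ℝ)..t, ε u / u)
  eps_diff : ∀ t ≥ (1:ℝ), DifferentiableAt ℝ ε t
  eps_diff2 : ∀ t ≥ (1:ℝ), DifferentiableAt ℝ (deriv ε) t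
  eps_to_zero : Tendsto ε atTop (nhds 0)
  eps_ratio1 : Tendsto (fun t => t * deriv ε t / ε t) atTop (nhds 0)
  eps_ratio2 : Tendsto (fun t => t ^ 2 * deriv (deriv ε) t / ε t) atTop (nhds 0)

lemma eventually_eventually_nhds_of_atTop {P : ℝ → Prop} (hP : ∀ᶠ t in atTop, P t) :
    ∀ᶠ t in atTop, ∀ᶠ s in nhds t, P s := by
  obtain ⟨T, hT⟩ := eventually_atTop.1 hP
  filter_upwards [eventually_gt_atTop T] with t ht
  filter_upwards [lt_mem_nhds ht] with s hs
  exact hT s hs.le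

/-- If `t q(t) ≤ D p(t)²` and `p(t)² ≤ C t³` eventually, then with `s = √(1/p)` both `q s⁴` and
`q s³ (log t)³` vanish at infinity. -/
lemma tendsto_mul_sqrt_inv_pow_zero {p q : ℝ → ℝ} {C D : ℝ}
    (hq : ∀ᶠ t in atTop, 0 ≤ q t) (hp : ∀ᶠ t in atTop, 0 < p t)
    (hpC : ∀ᶠ t in atTop, p t ^ 2 ≤ C * t ^ 3)
    (hqD : ∀ᶠ t in atTop, t * q t ≤ D * p t ^ 2) :
    Tendsto (fun t => q t * √(1 / p t) ^ 4) atTop (nhds 0) ∧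
      Tendsto (fun t => q t * √(1 / p t) ^ 3 * Real.log t ^ 3) atTop (nhds 0) := by
  have hbound : ∀ᶠ t in atTop, 0 ≤ q t * √(1 / p t) ^ 4 ∧ q t * √(1 / p t) ^ 4 ≤ D / t := by
    filter_upwards [hq, hp, hqD, eventually_gt_atTop 0] with t hq hp hqD ht
    refine ⟨by positivity, ?_⟩
    have h4 : √(1 / p t) ^ 4 = 1 / p t ^ 2 := by
      rw [show (4 : ℕ) = 2 * 2 from rfl, pow_mul, Real.sq_sqrt (by positivity), one_div_pow]
    rw [h4, mul_one_div, div_le_div_iff₀ (by positivity) ht]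
    linarith
  refine ⟨tendsto_of_tendsto_of_tendsto_of_le_of_le' tendsto_const_nhds
    (tendsto_const_nhds.div_atTop tendsto_id) (hbound.mono fun _ h => h.1)
    (hbound.mono fun _ h => h.2), ?_⟩
  have hlog : Tendsto (fun t : ℝ => D ^ 4 * C * (Real.log t ^ 12 / t)) atTop (nhds 0) := by
    simpa using (isLittleO_pow_log_id_atTop (n := 12)).tendsto_div_nhds_zero.const_mul (D ^ 4 * C)
  have hpow : Tendsto (fun t => (q t * √(1 / p t) ^ 3 * Real.log t ^ 3) ^ 4) atTop (nhds 0) := by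
    refine tendsto_of_tendsto_of_tendsto_of_le_of_le' tendsto_const_nhds hlog
      (Eventually.of_forall fun t => by positivity) ?_
    filter_upwards [hbound, hp, hpC, eventually_gt_atTop 0] with t hb hp hpC ht
    have hs : √(1 / p t) ^ 2 * p t = 1 := by
      rw [Real.sq_sqrt (by positivity), one_div_mul_cancel hp.ne']
    have hb4 : (q t * √(1 / p t) ^ 4) ^ 4 ≤ (D / t) ^ 4 := pow_le_pow_left₀ hb.1 hb.2 4
    calc (q t * √(1 / p t) ^ 3 * Real.log t ^ 3) ^ 4
        = (q t * √(1 / p t) ^ 3 * Real.log t ^ 3) ^ 4 * (√(1 / p t) ^ 2 * p t) ^ 2 := by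
          rw [hs]; ring
      _ = (q t * √(1 / p t) ^ 4) ^ 4 * p t ^ 2 * Real.log t ^ 12 := by ring
      _ ≤ (D / t) ^ 4 * (C * t ^ 3) * Real.log t ^ 12 := by gcongr
      _ = D ^ 4 * C * (Real.log t ^ 12 / t) := by field_simp
  have hsqrt := (hpow.sqrt).sqrt
  rw [Real.sqrt_zero, Real.sqrt_zero] at hsqrt
  refine tendsto_zero_iff_abs_tendsto_zero _ |>.2 (hsqrt.congr fun t => ?_)
  rw [show (4 : ℕ) = 2 * 2 from rfl, pow_mul, Real.sqrt_sq (by positivity), Real.sqrt_sq_eq_abs]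
  rfl

lemma hasDerivAt_exp_integral_div {ε : ℝ → ℝ} (hε : ∀ x ≥ (1:ℝ), DifferentiableAt ℝ ε x)
    {x : ℝ} (hx : 1 < x) :
    HasDerivAt (fun y => Real.exp (∫ u in (1:ℝ)..y, ε u / u))
      (Real.exp (∫ u in (1:ℝ)..x, ε u / u) * (ε x / x)) x := by
  have hcont : ∀ u ≥ (1:ℝ), ContinuousAt (fun u => ε u / u) u := fun u hu =>
    (hε u hu).continuousAt.div continuousAt_id (by linarith)
  have hmeas : StronglyMeasurableAtFilter (fun u => ε u / u) (nhds x) :=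
    ContinuousAt.stronglyMeasurableAtFilter isOpen_Ioi
      (fun u (hu : u ∈ Ioi (1:ℝ)) => hcont u (le_of_lt hu)) x hx
  refine (intervalIntegral.integral_hasDerivAt_right ?_ hmeas (hcont x hx.le)).exp
  refine ContinuousOn.intervalIntegrable fun u hu => (hcont u ?_).continuousWithinAt
  rw [uIcc_of_le hx.le] at hu
  exact hu.1

lemma Case1.hasDerivAt {h ε : ℝ → ℝ} {β c θ : ℝ} (H : Case1 h β c θ ε) {x : ℝ} (hx : 1 < x) :
    HasDerivAt h (h x / x * (β + ε x)) x := by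
  have hx0 : x ≠ 0 := by linarith
  have hd := (((hasDerivAt_id x).rpow_const (p := β) (Or.inl hx0)).const_mul c).mul
    (hasDerivAt_exp_integral_div H.eps_diff hx)
  have heq : h =ᶠ[nhds x]
      (fun y => c * y ^ β) * fun y => Real.exp (∫ u in (1:ℝ)..y, ε u / u) := by
    filter_upwards [lt_mem_nhds hx] with y hy
    exact H.h_eq y hy.le
  refine (hd.congr_of_eventuallyEq heq).congr_deriv ?_
  rw [H.h_eq x hx.le]
  simp only [id, Real.rpow_sub_one hx0]
  field_simp

lemma Case1.hasDerivAt_deriv {h ε : ℝ → ℝ} {β c θ : ℝ} (H : Case1 h β c θ ε) {x : ℝ}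
    (hx : 1 < x) :
    HasDerivAt (deriv h)
      (h x / x ^ 2 * ((β + ε x) * (β + ε x - 1) + x * deriv ε x)) x := by
  have hx0 : x ≠ 0 := by linarith
  have hd := ((H.hasDerivAt hx).div (hasDerivAt_id x) hx0).mul
    ((H.eps_diff x hx.le).hasDerivAt.const_add β)
  have heq : deriv h =ᶠ[nhds x] (h / id) * fun y => β + ε y := by
    filter_upwards [lt_mem_nhds hx] with y hy
    exact (H.hasDerivAt hy).deriv
  refine (hd.congr_of_eventuallyEq heq).congr_deriv ?_
  simp only [id, Pi.div_apply]
  field_simp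

/-- In the regularly varying case `h' > 0`, `h'² ≤ A h²` and `|h''| h ≤ D h'²` eventually. -/
lemma Case1.exists_deriv_bounds {h ε : ℝ → ℝ} {β c θ : ℝ} (H : Case1 h β c θ ε) :
    ∃ A D : ℝ, ∀ᶠ x in atTop, 0 < deriv h x ∧ deriv h x ^ 2 ≤ A * h x ^ 2 ∧
      h x * |deriv (deriv h) x| ≤ D * deriv h x ^ 2 := by
  have hβ := H.beta_pos
  obtain ⟨M, hM⟩ := H.eps_deriv_bigO.bound
  have hε0 : ∀ᶠ x in atTop, |ε x| < min 1 (β / 2) := by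
    have := H.eps_to_zero.abs
    rw [abs_zero] at this
    exact this.eventually_lt_const (by positivity)
  refine ⟨(β + 1) ^ 2, ((β + 1) * (β + 2) + M) * (4 / β ^ 2), ?_⟩
  filter_upwards [hM, hε0, eventually_gt_atTop 1] with x hM hε hx
  rw [(H.hasDerivAt hx).deriv, (H.hasDerivAt_deriv hx).deriv]
  have hx0 : 0 < x := by linarith
  have hh : 0 < h x := by
    rw [H.h_eq x hx.le]
    have := H.c_pos
    positivity
  obtain ⟨h1, h2⟩ := lt_min_iff.1 hε
  rw [abs_lt] at h1 h2
  simp only [norm_one, mul_one, Real.norm_eq_abs] at hM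
  have hb : 0 < β + ε x := by linarith
  refine ⟨by positivity, ?_, ?_⟩
  · have hle : h x / x ≤ h x := div_le_self hh.le hx.le
    calc (h x / x * (β + ε x)) ^ 2 ≤ (h x * (β + 1)) ^ 2 := by
          gcongr
          linarith
      _ = (β + 1) ^ 2 * h x ^ 2 := by ring
  · have hE : |(β + ε x) * (β + ε x - 1) + x * deriv ε x| ≤ (β + 1) * (β + 2) + M := by
      refine (abs_add_le _ _).trans (add_le_add ?_ hM)
      rw [abs_mul]
      refine mul_le_mul ?_ ?_ (abs_nonneg _) (by positivity) <;> rw [abs_le] <;>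
        constructor <;> linarith
    have hlow : 1 ≤ 4 / β ^ 2 * (β + ε x) ^ 2 := by
      rw [div_mul_eq_mul_div, one_le_div (by positivity)]
      nlinarith
    rw [abs_mul, abs_of_pos (by positivity : 0 < h x / x ^ 2)]
    calc h x * (h x / x ^ 2 * |(β + ε x) * (β + ε x - 1) + x * deriv ε x|)
        = (h x / x) ^ 2 * |(β + ε x) * (β + ε x - 1) + x * deriv ε x| * 1 := by
          field_simp
      _ ≤ (h x / x) ^ 2 * ((β + 1) * (β + 2) + M) * (4 / β ^ 2 * (β + ε x) ^ 2) := by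
          have := (abs_nonneg _).trans hE
          gcongr
      _ = ((β + 1) * (β + 2) + M) * (4 / β ^ 2) * (h x / x * (β + ε x)) ^ 2 := by ring

lemma Case2.hasDerivAt {ψ ε : ℝ → ℝ} {c : ℝ} (H : Case2 ψ c ε) {t : ℝ} (ht : 1 < t) :
    HasDerivAt ψ (ψ t * ε t / t) t := by
  have hd := (hasDerivAt_exp_integral_div H.eps_diff ht).const_mul c
  have heq : ψ =ᶠ[nhds t] fun y => c * Real.exp (∫ u in (1:ℝ)..y, ε u / u) := by
    filter_upwards [lt_mem_nhds ht] with y hy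
    exact H.psi_eq y hy.le
  refine (hd.congr_of_eventuallyEq heq).congr_deriv ?_
  rw [H.psi_eq t ht.le]
  ring

/-- A function with `t ε'(t) / ε(t) → 0` decays more slowly than `t ^ (-1/2)`. -/
lemma exists_pos_le_mul_sq {ε : ℝ → ℝ} (hd : ∀ t ≥ (1:ℝ), DifferentiableAt ℝ ε t)
    (hpos : ∀ᶠ t in atTop, 0 < ε t)
    (hr : Tendsto (fun t => t * deriv ε t / ε t) atTop (nhds 0)) :
    ∃ K > 0, ∀ᶠ t in atTop, K ≤ t * ε t ^ 2 := by
  obtain ⟨T, hT⟩ := eventually_atTop.1 ((hpos.and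
    (hr.eventually_const_lt (show (-1 / 2 : ℝ) < 0 by norm_num))).and (eventually_ge_atTop 1))
  have hderiv : ∀ t ≥ T, HasDerivAt (fun t => t * ε t ^ 2)
      (1 * ε t ^ 2 + t * (2 * ε t * deriv ε t)) t := fun t ht => by
    have := (hasDerivAt_id t).mul ((hd t (hT t ht).2).hasDerivAt.pow 2)
    simpa [Pi.mul_def, Pi.pow_def] using this
  have hmono : MonotoneOn (fun t => t * ε t ^ 2) (Ici T) := by
    refine monotoneOn_of_deriv_nonneg (convex_Ici T)
      (fun t ht => (hderiv t ht).continuousAt.continuousWithinAt)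
      (fun t ht => (hderiv t (interior_subset ht)).differentiableAt.differentiableWithinAt)
      fun t ht => ?_
    have ht := interior_subset ht
    obtain ⟨⟨hε, hlow⟩, -⟩ := hT t ht
    rw [(hderiv t ht).deriv]
    rw [lt_div_iff₀ hε] at hlow
    nlinarith
  refine ⟨T * ε T ^ 2, ?_, ?_⟩
  · obtain ⟨⟨hε, -⟩, h1⟩ := hT T le_rfl
    have : 0 < T := by linarith
    positivity
  · filter_upwards [eventually_ge_atTop T] with t ht
    exact hmono self_mem_Ici ht ht

/-- In the rapidly varying case, `h'(ψ(t)) > 0`, `h'(ψ(t))² ≤ C t³` and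
`t |h''(ψ(t))| ≤ D h'(ψ(t))²` eventually. -/
lemma Case2.exists_deriv_bounds {h ψ ε : ℝ → ℝ} {c : ℝ} (H : Case2 ψ c ε)
    (hd : ∀ x > (0:ℝ), DifferentiableAt ℝ h x)
    (hd2 : ∀ x > (0:ℝ), DifferentiableAt ℝ (deriv h) x)
    (hnn : ∀ᶠ x in atTop, 0 ≤ deriv h x)
    (hinv : ∀ᶠ t in atTop, h (ψ t) = t) (hψ : Tendsto ψ atTop atTop) :
    ∃ C D : ℝ, ∀ᶠ t in atTop, 0 < deriv h (ψ t) ∧ deriv h (ψ t) ^ 2 ≤ C * t ^ 3 ∧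
      t * |deriv (deriv h) (ψ t)| ≤ D * deriv h (ψ t) ^ 2 := by
  have hev : ∀ᶠ t in atTop, 0 < ε t ∧ deriv h (ψ t) = t / (ψ t * ε t) := by
    filter_upwards [hψ.eventually hnn, hψ.eventually_gt_atTop 0, eventually_gt_atTop 1,
      eventually_eventually_nhds_of_atTop hinv] with t hnn hψ0 ht hinv
    have ht0 : 0 < t := by linarith
    have hone : deriv h (ψ t) * (ψ t * ε t / t) = 1 :=
      ((hd _ hψ0).hasDerivAt.comp t (H.hasDerivAt ht)).unique
        ((hasDerivAt_id t).congr_of_eventuallyEq hinv)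
    have hε : 0 < ε t := by
      by_contra! hε
      have : ψ t * ε t / t ≤ 0 :=
        div_nonpos_of_nonpos_of_nonneg (mul_nonpos_of_nonneg_of_nonpos hψ0.le hε) ht0.le
      nlinarith
    refine ⟨hε, ?_⟩
    field_simp at hone ⊢
    linarith
  obtain ⟨K, hK, hKε⟩ := exists_pos_le_mul_sq H.eps_diff (hev.mono fun _ h => h.1) H.eps_ratio1
  have hE : ∀ᶠ t in atTop, |1 - ε t - t * deriv ε t / ε t| < 2 := by
    have := ((tendsto_const_nhds (x := (1:ℝ))).sub H.eps_to_zero |>.sub H.eps_ratio1).abs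
    exact this.eventually_lt_const (by norm_num)
  refine ⟨1 / K, 2, ?_⟩
  filter_upwards [hKε, hE, hψ.eventually_ge_atTop 1, eventually_gt_atTop 1, hev,
    eventually_eventually_nhds_of_atTop hev] with t hKε hE hψ1 ht hev hnear
  obtain ⟨hε, heq⟩ := hev
  have ht0 : 0 < t := by linarith
  have hψ0 : 0 < ψ t := by linarith
  refine ⟨by rw [heq]; positivity, ?_, ?_⟩
  · rw [heq, div_pow, div_mul_eq_mul_div, one_mul, div_le_div_iff₀ (by positivity) hK]
    have : ε t ^ 2 ≤ (ψ t * ε t) ^ 2 := by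
      gcongr
      exact le_mul_of_one_le_left hε.le hψ1
    calc t ^ 2 * K ≤ t ^ 2 * (t * ε t ^ 2) := by gcongr
      _ = t ^ 3 * ε t ^ 2 := by ring
      _ ≤ t ^ 3 * (ψ t * ε t) ^ 2 := by gcongr
  · have hchain := (hd2 _ hψ0).hasDerivAt.comp t (H.hasDerivAt ht)
    have hquot := (hasDerivAt_id t).div
      ((H.hasDerivAt ht).mul (H.eps_diff t ht.le).hasDerivAt) (mul_pos hψ0 hε).ne'
    have huniq := hchain.unique (hquot.congr_of_eventuallyEq (hnear.mono fun _ h => h.2))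
    have h2 : t * deriv (deriv h) (ψ t)
        = (1 - ε t - t * deriv ε t / ε t) * (t / (ψ t * ε t)) ^ 2 := by
      simp only [id, Pi.mul_apply] at huniq
      field_simp at huniq ⊢
      linarith
    calc t * |deriv (deriv h) (ψ t)| = |t * deriv (deriv h) (ψ t)| := by
          rw [abs_mul, abs_of_pos ht0]
      _ = |1 - ε t - t * deriv ε t / ε t| * deriv h (ψ t) ^ 2 := by
          rw [h2, abs_mul, abs_sq, heq]
      _ ≤ 2 * deriv h (ψ t) ^ 2 := by gcongr

/-- with `x̂ = ψ(t)`, `σ̂ = σ(ψ(t))` and `L(t) = (log t)³`, both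
`|h''(x̂)| σ̂⁴ → 0` and `|h''(x̂)| σ̂³ L(t) → 0` as `t → ∞`. -/
theorem h2_sigma_vanishes
    (g ψ : ℝ → ℝ)
    (hg_pos : ∀ x > (0:ℝ), 0 < g x)
    (hg_conv : ConvexOn ℝ (Set.Ioi 0) g)
    (hg_smooth : ContDiffOn ℝ 4 g (Set.Ioi 0))
    (hg_super : Tendsto (fun x => g x / x) atTop atTop)
    (hh_mono : ∃ x₀ : ℝ, StrictMonoOn (deriv g) (Set.Ioi x₀))
    (hh_top : Tendsto (deriv g) atTop atTop)
    (hψ_inv : ∀ᶠ t in atTop, deriv g (ψ t) = t)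
    (hψ_inv' : ∀ᶠ x in atTop, ψ (deriv g x) = x)
    (hψ_top : Tendsto ψ atTop atTop)
    (hcase :
      (∃ β c θ ε, Case1 (deriv g) β c θ ε) ∨ (∃ c ε, Case2 ψ c ε))
    : Tendsto (fun t =>
        |iteratedDeriv 2 (deriv g) (ψ t)| * (Real.sqrt (1 / deriv (deriv g) (ψ t))) ^ 4)
      atTop (nhds 0) ∧
    Tendsto (fun t =>
        |iteratedDeriv 2 (deriv g) (ψ t)| * (Real.sqrt (1 / deriv (deriv g) (ψ t))) ^ 3 *
          (Real.log t) ^ 3)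
      atTop (nhds 0) := by
  have hg1 : ContDiffOn ℝ 3 (deriv g) (Ioi 0) :=
    hg_smooth.deriv_of_isOpen isOpen_Ioi (by norm_num)
  have hg2 : ContDiffOn ℝ 2 (deriv (deriv g)) (Ioi 0) :=
    hg1.deriv_of_isOpen isOpen_Ioi (by norm_num)
  have hd : ∀ x > (0:ℝ), DifferentiableAt ℝ (deriv g) x := fun x hx =>
    (hg1.contDiffAt (Ioi_mem_nhds hx)).differentiableAt (by norm_num)
  have hd2 : ∀ x > (0:ℝ), DifferentiableAt ℝ (deriv (deriv g)) x := fun x hx =>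
    (hg2.contDiffAt (Ioi_mem_nhds hx)).differentiableAt (by norm_num)
  have hnn : ∀ᶠ x in atTop, 0 ≤ deriv (deriv g) x := by
    obtain ⟨x₀, hx₀⟩ := hh_mono
    filter_upwards [eventually_gt_atTop x₀] with x hx
    rw [← derivWithin_of_isOpen isOpen_Ioi hx]
    exact hx₀.monotoneOn.derivWithin_nonneg
  obtain ⟨C, D, hCD⟩ : ∃ C D : ℝ, ∀ᶠ t in atTop, 0 < deriv (deriv g) (ψ t) ∧
      deriv (deriv g) (ψ t) ^ 2 ≤ C * t ^ 3 ∧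
      t * |deriv (deriv (deriv g)) (ψ t)| ≤ D * deriv (deriv g) (ψ t) ^ 2 := by
    rcases hcase with ⟨β, c, θ, ε, H⟩ | ⟨c, ε, H⟩
    · obtain ⟨A, D, hAD⟩ := H.exists_deriv_bounds
      refine ⟨|A|, D, ?_⟩
      filter_upwards [hψ_top.eventually hAD, hψ_inv, eventually_ge_atTop 1] with t ht hinv ht1
      rw [hinv] at ht
      refine ⟨ht.1, ht.2.1.trans ?_, ht.2.2⟩
      have : t ^ 2 ≤ t ^ 3 := pow_le_pow_right₀ ht1 (by norm_num)
      exact mul_le_mul (le_abs_self A) this (by positivity) (abs_nonneg A)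
    · exact H.exists_deriv_bounds hd hd2 hnn hψ_inv hψ_top
  simp only [iteratedDeriv_succ, iteratedDeriv_zero]
  exact tendsto_mul_sqrt_inv_pow_zero (Eventually.of_forall fun t => abs_nonneg _)
    (hCD.mono fun _ h => h.1) (hCD.mono fun _ h => h.2.1) (hCD.mono fun _ h => h.2.2)
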